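/- Let (ε_j)_{j≥1} be a nonincreasing sequence of positive real numbers with ε_1 ≤ 2^{−8} and ε_{j+1} ≥ ε_j/2 for all j, and let δ satisfy ε_1 ≤ δ ≤ min(1/200, 1 − ε_1). Set c_j = 1 − 2δ^j, r_j = ε_j·δ^j, Δ_j = {z ∈ ℂ : |z − c_j| < r_j}, and m_{i,j} = (1/(r_i r_j)) ∫_{Δ_j} ∫_{Δ_i} (1 − w·conj(z))^{−2} dA(z) dA(w). For a fixed n ≥ 1, let N be the n × n complex matrix with entries ν_{i,i} = 0 and ν_{i,j} = m_{i,j}/m_{i,i} for i ≠ j (1 ≤ i, j ≤ n). Then the operator norm of N acting on the Euclidean space ℂⁿ satisfies ‖N‖ ≤ 1/2. -/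

import Mathlib

open MeasureTheory
open scoped ENNReal

/-- The normalized area measure `dA = dx dy / π` on `ℂ`. -/
noncomputable def areaA : Measure ℂ := (ENNReal.ofReal (1 / Real.pi)) • volume

/-- The entries `m_{i,j} = (1/(r_i r_j)) ∬_{Δ_i × Δ_j} (1 - w conj z)^{-2} dA(z) dA(w)`,
where `Δ_j` is the disk of center `c_j = 1 - 2δ^j` and radius `r_j = ε_j δ^j`. -/
noncomputable def mEntry (ε : ℕ → ℝ) (δ : ℝ) (i j : ℕ) : ℂ :=
  (1 / (((ε i * δ ^ i) * (ε j * δ ^ j) : ℝ) : ℂ)) *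
    ∫ w in Metric.ball (((1 - 2 * δ ^ j : ℝ)) : ℂ) (ε j * δ ^ j),
      ∫ z in Metric.ball (((1 - 2 * δ ^ i : ℝ)) : ℂ) (ε i * δ ^ i),
        ((1 - w * (starRingEnd ℂ) z) ^ 2)⁻¹ ∂areaA ∂areaA


open Real Set Metric in
/-- Area mean value property: the integral over a disk of a function holomorphic near its
closure. -/
theorem setIntegral_ball_of_differentiableOn {f : ℂ → ℂ} {c : ℂ} {r : ℝ} (hr : 0 < r)
    (hf : DifferentiableOn ℂ f (closedBall c r)) :
    ∫ z in ball c r, f z = ((π * r ^ 2 : ℝ) : ℂ) * f c := by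
  have hcirc : ∀ ρ ∈ Ioo 0 r, ∫ θ in Ioo (-π) π, f (c + Complex.polarCoord.symm (ρ, θ)) =
      ((2 * π : ℝ) : ℂ) * f c := by
    intro ρ hρ
    have hd : DiffContOnCl ℂ f (ball c |ρ|) := by
      rw [abs_of_pos hρ.1]
      exact (hf.mono (closedBall_subset_closedBall hρ.2.le)).diffContOnCl_ball subset_rfl
    have h1 := hd.circleAverage
    rw [circleAverage_def] at h1
    have h2 : ∫ θ in (0 : ℝ)..2 * π, f (circleMap c ρ θ) = ((2 * π : ℝ) : ℂ) * f c := by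
      rw [← h1, Complex.real_smul, ← mul_assoc, ← Complex.ofReal_mul,
        mul_inv_cancel₀ (by positivity)]
      simp
    have hper : Function.Periodic (fun θ => f (circleMap c ρ θ)) (2 * π) := by
      intro θ
      simp only [periodic_circleMap c ρ θ]
    have h3 := hper.intervalIntegral_add_eq (-π) 0
    rw [zero_add, h2, show -π + 2 * π = π by ring,
      intervalIntegral.integral_of_le (by linarith [pi_pos]), integral_Ioc_eq_integral_Ioo] at h3
    rw [← h3]
    congr 1 with θ
    rw [circleMap, Complex.polarCoord_symm_apply, Complex.exp_mul_I]
    push_cast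
    rfl
  have htrans : ∫ z in ball c r, f z = ∫ z, (ball (0 : ℂ) r).indicator (fun z => f (c + z)) z := by
    rw [← integral_indicator measurableSet_ball, ← integral_add_left_eq_self _ c]
    congr 1 with z
    simp [indicator, dist_eq_norm]
  have hsub : Ioo 0 r ×ˢ Ioo (-π) π ⊆ polarCoord.target := by
    rintro ⟨a, b⟩ ⟨h1, h2⟩
    rw [polarCoord_target]
    exact ⟨h1.1, h2⟩
  have hrestr : ∫ p in polarCoord.target, p.1 •
        (ball (0 : ℂ) r).indicator (fun z => f (c + z)) (Complex.polarCoord.symm p) =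
      ∫ p in Ioo 0 r ×ˢ Ioo (-π) π, (p.1 : ℂ) * f (c + Complex.polarCoord.symm p) := by
    refine (setIntegral_eq_of_subset_of_forall_sdiff_eq_zero
      polarCoord.open_target.measurableSet hsub ?_).trans
      (setIntegral_congr_fun (measurableSet_Ioo.prod measurableSet_Ioo) ?_)
    · rintro ⟨a, b⟩ ⟨h1, h2⟩
      rw [polarCoord_target] at h1
      have ha : 0 < a := h1.1
      have hm : Complex.polarCoord.symm (a, b) ∉ ball (0 : ℂ) r := by
        rw [mem_ball_zero_iff, Complex.norm_polarCoord_symm, abs_of_pos ha]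
        exact fun h => h2 ⟨⟨ha, h⟩, h1.2⟩
      simp only [indicator_of_notMem hm, smul_zero]
    · rintro ⟨a, b⟩ ⟨h1, h2⟩
      have hm : Complex.polarCoord.symm (a, b) ∈ ball (0 : ℂ) r := by
        rw [mem_ball_zero_iff, Complex.norm_polarCoord_symm, abs_of_pos h1.1]
        exact h1.2
      simp only [indicator_of_mem hm, Complex.real_smul]
  have hint : IntegrableOn (fun p : ℝ × ℝ => (p.1 : ℂ) * f (c + Complex.polarCoord.symm p))
      (Ioo 0 r ×ˢ Ioo (-π) π) := by
    have hpc : Continuous fun p : ℝ × ℝ => Complex.polarCoord.symm p := by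
      simp only [Complex.polarCoord_symm_apply]
      fun_prop
    refine IntegrableOn.mono_set (t := Icc 0 r ×ˢ Icc (-π) π) ?_
      (prod_mono Ioo_subset_Icc_self Ioo_subset_Icc_self)
    refine ContinuousOn.integrableOn_compact (isCompact_Icc.prod isCompact_Icc) ?_
    refine ContinuousOn.mul (by fun_prop) (hf.continuousOn.comp (by fun_prop) ?_)
    rintro ⟨a, b⟩ ⟨h1, -⟩
    rw [mem_closedBall, dist_eq_norm, add_sub_cancel_left, Complex.norm_polarCoord_symm,
      abs_of_nonneg h1.1]
    exact h1.2
  rw [htrans, ← Complex.integral_comp_polarCoord_symm, hrestr]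
  rw [Measure.volume_eq_prod] at hint ⊢
  rw [setIntegral_prod _ hint]
  have hin : ∀ ρ ∈ Ioo 0 r, ∫ θ in Ioo (-π) π, (ρ : ℂ) * f (c + Complex.polarCoord.symm (ρ, θ)) =
      (ρ : ℂ) * (((2 * π : ℝ) : ℂ) * f c) := by
    intro ρ hρ
    rw [integral_const_mul, hcirc ρ hρ]
  rw [setIntegral_congr_fun measurableSet_Ioo hin, integral_mul_const,
    ← integral_Ioc_eq_integral_Ioo, ← intervalIntegral.integral_of_le hr.le,
    intervalIntegral.integral_ofReal, integral_id]
  push_cast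
  ring

/-- The area mean value property for the normalized measure. -/
theorem setIntegral_ball_areaA {f : ℂ → ℂ} {c : ℂ} {r : ℝ} (hr : 0 < r)
    (hf : DifferentiableOn ℂ f (Metric.closedBall c r)) :
    ∫ z in Metric.ball c r, f z ∂areaA = (r : ℂ) ^ 2 * f c := by
  rw [areaA, Measure.restrict_smul, integral_smul_measure,
    setIntegral_ball_of_differentiableOn hr hf, ENNReal.toReal_ofReal (by positivity),
    Complex.real_smul]
  have : (Real.pi : ℂ) ≠ 0 := by exact_mod_cast Real.pi_ne_zero
  push_cast
  field_simp

theorem norm_lt_one_of_mem_closedBall {c r : ℝ} (h : |c| + r < 1) {z : ℂ}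
    (hz : z ∈ Metric.closedBall (c : ℂ) r) : ‖z‖ < 1 := by
  rw [Metric.mem_closedBall, dist_eq_norm] at hz
  have h1 := norm_add_le (z - c) (c : ℂ)
  rw [sub_add_cancel, Complex.norm_real, Real.norm_eq_abs] at h1
  linarith

theorem one_sub_mul_ne_zero {z w : ℂ} (hz : ‖z‖ < 1) (hw : ‖w‖ < 1) : 1 - w * z ≠ 0 := by
  intro h
  have h1 : ‖w * z‖ = 1 := by rw [← sub_eq_zero.1 h, norm_one]
  rw [norm_mul] at h1
  nlinarith [norm_nonneg z, norm_nonneg w]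

/-- Integral of the conjugate-analytic Bergman kernel over two disks inside the unit disk. -/
theorem integral_bergman_disks {a b r s : ℝ} (hr : 0 < r) (hs : 0 < s)
    (ha : |a| + r < 1) (hb : |b| + s < 1) :
    ∫ w in Metric.ball (b : ℂ) s, ∫ z in Metric.ball (a : ℂ) r,
      ((1 - w * (starRingEnd ℂ) z) ^ 2)⁻¹ ∂areaA ∂areaA =
      ((r ^ 2 * s ^ 2 / (1 - a * b) ^ 2 : ℝ) : ℂ) := by
  have hcenter : ‖(a : ℂ)‖ < 1 := by
    rw [Complex.norm_real, Real.norm_eq_abs]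
    linarith
  have hinner : ∀ w ∈ Metric.ball (b : ℂ) s, ∫ z in Metric.ball (a : ℂ) r,
      ((1 - w * (starRingEnd ℂ) z) ^ 2)⁻¹ ∂areaA = (r : ℂ) ^ 2 * ((1 - w * a) ^ 2)⁻¹ := by
    intro w hw
    have hw1 : ‖(starRingEnd ℂ) w‖ < 1 := by
      rw [RCLike.norm_conj]
      exact norm_lt_one_of_mem_closedBall hb (Metric.ball_subset_closedBall hw)
    have hconj : ∀ z : ℂ, ((1 - w * (starRingEnd ℂ) z) ^ 2)⁻¹ =
        (starRingEnd ℂ) (((1 - (starRingEnd ℂ) w * z) ^ 2)⁻¹) := by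
      intro z
      simp
    simp_rw [hconj]
    rw [integral_conj, setIntegral_ball_areaA hr]
    · simp
    · refine DifferentiableOn.inv (by fun_prop) fun z hz => ?_
      exact pow_ne_zero 2 (one_sub_mul_ne_zero (norm_lt_one_of_mem_closedBall ha hz) hw1)
  rw [setIntegral_congr_fun measurableSet_ball hinner, setIntegral_ball_areaA hs]
  · push_cast
    rw [mul_comm (a : ℂ) b]
    field_simp
  · refine DifferentiableOn.const_mul (DifferentiableOn.inv (by fun_prop) fun w hw => ?_) _
    exact pow_ne_zero 2 (one_sub_mul_ne_zero hcenter (norm_lt_one_of_mem_closedBall hb hw))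

/-- Closed form of the matrix entries. -/
theorem mEntry_eq {ε : ℕ → ℝ} {δ : ℝ} {i j : ℕ} (hδ : 0 < δ) (hδ' : δ ≤ 1 / 200)
    (hi : 1 ≤ i) (hj : 1 ≤ j) (hεi : 0 < ε i) (hεj : 0 < ε j) (hεi' : ε i ≤ 1)
    (hεj' : ε j ≤ 1) :
    mEntry ε δ i j = ((ε i * δ ^ i * (ε j * δ ^ j) /
      (2 * δ ^ i + 2 * δ ^ j - 4 * δ ^ i * δ ^ j) ^ 2 : ℝ) : ℂ) := by
  have hbound : ∀ k, 1 ≤ k → 0 < ε k → ε k ≤ 1 →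
      0 < ε k * δ ^ k ∧ |1 - 2 * δ ^ k| + ε k * δ ^ k < 1 := by
    intro k hk h1 h2
    have hp : 0 < δ ^ k := pow_pos hδ k
    have hle : δ ^ k ≤ δ := pow_le_of_le_one hδ.le (by linarith) (by omega)
    refine ⟨by positivity, ?_⟩
    rw [abs_of_nonneg (by linarith)]
    nlinarith
  obtain ⟨hi1, hi2⟩ := hbound i hi hεi hεi'
  obtain ⟨hj1, hj2⟩ := hbound j hj hεj hεj'
  rw [mEntry, integral_bergman_disks hi1 hj1 hi2 hj2, ← Complex.ofReal_one, ← Complex.ofReal_div,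
    ← Complex.ofReal_mul]
  congr 1
  rw [show 1 - (1 - 2 * δ ^ i) * (1 - 2 * δ ^ j) =
    2 * δ ^ i + 2 * δ ^ j - 4 * δ ^ i * δ ^ j by ring]
  generalize hd : 2 * δ ^ i + 2 * δ ^ j - 4 * δ ^ i * δ ^ j = d
  generalize ε i * δ ^ i = x at *
  generalize ε j * δ ^ j = y at *
  by_cases h0 : d = 0
  · simp [h0]
  · field_simp

/-- Off-diagonal decay of the normalized entries. -/
theorem norm_mEntry_div_le {ε : ℕ → ℝ} {δ : ℝ} (hpos : ∀ j, 1 ≤ j → 0 < ε j)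
    (hmono : ∀ j k, 1 ≤ j → j ≤ k → ε k ≤ ε j) (hhalf : ∀ j, 1 ≤ j → ε j / 2 ≤ ε (j + 1))
    (hε1 : ε 1 ≤ 1) (hδ : 0 < δ) (hδ' : δ ≤ 1 / 200) {i j : ℕ} (hi : 1 ≤ i) (hj : 1 ≤ j)
    (hij : i ≠ j) :
    ‖mEntry ε δ i j / mEntry ε δ i i‖ ≤ 4 * (1 / 100) ^ (Nat.dist i j) := by
  have hle1 : ∀ k, 1 ≤ k → ε k ≤ 1 := fun k hk => (hmono 1 k le_rfl hk).trans hε1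
  have hgeom : ∀ j, 1 ≤ j → ∀ k, ε j ≤ 2 ^ k * ε (j + k) := by
    intro j hj k
    induction k with
    | zero => simp
    | succ k ih =>
      have h1 := hhalf (j + k) (by omega)
      have h2 : (0 : ℝ) < 2 ^ k := by positivity
      rw [pow_succ, ← add_assoc]
      nlinarith
  have hpow : ∀ k, 1 ≤ k → 0 < δ ^ k ∧ δ ^ k ≤ δ := fun k hk =>
    ⟨pow_pos hδ k, pow_le_of_le_one hδ.le (by linarith) (by omega)⟩
  rw [mEntry_eq hδ hδ' hi hj (hpos i hi) (hpos j hj) (hle1 i hi) (hle1 j hj),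
    mEntry_eq hδ hδ' hi hi (hpos i hi) (hpos i hi) (hle1 i hi) (hle1 i hi),
    ← Complex.ofReal_div, Complex.norm_real, Real.norm_eq_abs]
  have hpi := hpos i hi
  have hpj := hpos j hj
  rcases lt_or_gt_of_ne hij with h | h
  · obtain ⟨m, rfl⟩ := Nat.exists_eq_add_of_le h.le
    obtain ⟨hx, hx'⟩ := hpow i hi
    obtain ⟨hy, hy'⟩ := hpow m (by omega)
    rw [Nat.dist_eq_sub_of_le (by omega), Nat.add_sub_cancel_left]
    have hε := hmono i (i + m) hi (by omega)
    have hy100 : δ ^ m ≤ (1 / 100) ^ m := pow_le_pow_left₀ hδ.le (by linarith) m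
    rw [pow_add]
    generalize δ ^ i = x at *
    generalize δ ^ m = y at *
    generalize ε i = e at *
    generalize ε (i + m) = e' at *
    have hd1 : 0 < 1 - x := by linarith
    have hd2 : 1 - x ≤ 1 + y - 2 * (x * y) := by nlinarith
    have key : e * x * (e' * (x * y)) / (2 * x + 2 * (x * y) - 4 * x * (x * y)) ^ 2 /
        (e * x * (e * x) / (2 * x + 2 * x - 4 * x * x) ^ 2) =
        (e' / e) * (4 * y) * ((1 - x) / (1 + y - 2 * (x * y))) ^ 2 := by
      have e1 : 2 * x + 2 * (x * y) - 4 * x * (x * y) = 2 * x * (1 + y - 2 * (x * y)) := by ring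
      have e2 : 2 * x + 2 * x - 4 * x * x = 4 * x * (1 - x) := by ring
      rw [e1, e2]
      have : 0 < 1 + y - 2 * (x * y) := by linarith
      generalize 1 + y - 2 * (x * y) = D at *
      generalize 1 - x = E at *
      field_simp
      norm_num
    have hD : 0 < 1 + y - 2 * (x * y) := by linarith
    rw [key, abs_of_nonneg (by positivity)]
    have a1 : e' / e ≤ 1 := by rw [div_le_one hpi]; exact hε
    have a2 : ((1 - x) / (1 + y - 2 * (x * y))) ^ 2 ≤ 1 :=
      pow_le_one₀ (div_nonneg hd1.le hD.le) (by rw [div_le_one hD]; exact hd2)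
    calc _ ≤ 1 * (4 * y) * 1 := by gcongr
      _ ≤ _ := by linarith
  · obtain ⟨m, rfl⟩ := Nat.exists_eq_add_of_le h.le
    obtain ⟨hx, hx'⟩ := hpow j hj
    obtain ⟨hy, hy'⟩ := hpow m (by omega)
    rw [Nat.dist_eq_sub_of_le_right (by omega), Nat.add_sub_cancel_left]
    have hε := hgeom j hj m
    have hy100 : 2 ^ m * δ ^ m ≤ (1 / 100) ^ m := by
      rw [← mul_pow]
      exact pow_le_pow_left₀ (by positivity) (by linarith) m
    rw [pow_add]
    generalize δ ^ j = x at *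
    generalize δ ^ m = y at *
    generalize ε j = e' at *
    generalize ε (j + m) = e at *
    have hd1 : 0 < 1 - x * y := by nlinarith
    have hd2 : 1 - x * y ≤ 1 + y - 2 * (x * y) := by nlinarith
    have hD : 0 < 1 + y - 2 * (x * y) := by linarith
    have key : e * (x * y) * (e' * x) / (2 * (x * y) + 2 * x - 4 * (x * y) * x) ^ 2 /
        (e * (x * y) * (e * (x * y)) / (2 * (x * y) + 2 * (x * y) - 4 * (x * y) * (x * y)) ^ 2) =
        (e' / e) * (4 * y) * ((1 - x * y) / (1 + y - 2 * (x * y))) ^ 2 := by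
      have e1 : 2 * (x * y) + 2 * x - 4 * (x * y) * x = 2 * x * (1 + y - 2 * (x * y)) := by ring
      have e2 : 2 * (x * y) + 2 * (x * y) - 4 * (x * y) * (x * y) =
        4 * x * y * (1 - x * y) := by ring
      rw [e1, e2]
      generalize 1 + y - 2 * (x * y) = D at *
      generalize 1 - x * y = E at *
      field_simp
      norm_num
    rw [key, abs_of_nonneg (by positivity)]
    have a1 : e' / e ≤ 2 ^ m := by rw [div_le_iff₀ hpi]; exact hε
    have a2 : ((1 - x * y) / (1 + y - 2 * (x * y))) ^ 2 ≤ 1 :=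
      pow_le_one₀ (div_nonneg hd1.le hD.le) (by rw [div_le_one hD]; exact hd2)
    calc _ ≤ 2 ^ m * (4 * y) * 1 := by gcongr
      _ ≤ _ := by linarith

theorem sum_range_geometric_dist_le (i n : ℕ) :
    ∑ j ∈ Finset.range n, (if i = j then 0 else (1 / 100 : ℝ) ^ (Nat.dist i j)) ≤ 2 / 99 := by
  have hlow : ∀ n, ∀ d, n + d = i →
      ∑ j ∈ Finset.range n, (if i = j then 0 else (1 / 100 : ℝ) ^ (Nat.dist i j)) ≤
        (1 / 100) ^ d / 99 := by
    intro n
    induction n with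
    | zero => intro d _; simp only [Finset.range_zero, Finset.sum_empty]; positivity
    | succ n ih =>
      intro d hd
      have h1 := ih (d + 1) (by omega)
      rw [Finset.sum_range_succ, if_neg (by omega), Nat.dist_eq_sub_of_le_right (by omega),
        show i - n = d + 1 by omega]
      rw [pow_succ] at *
      linarith
  have hhigh : ∀ d,
      ∑ j ∈ Finset.range (i + 1 + d), (if i = j then 0 else (1 / 100 : ℝ) ^ (Nat.dist i j)) ≤
        2 / 99 - (1 / 100) ^ d / 99 := by
    intro d
    induction d with
    | zero =>
      have h1 := hlow i 0 rfl
      rw [add_zero, Finset.sum_range_succ, if_pos rfl]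
      norm_num at h1 ⊢
      linarith
    | succ d ih =>
      rw [← add_assoc, Finset.sum_range_succ, if_neg (by omega),
        Nat.dist_eq_sub_of_le (by omega), show i + 1 + d - i = d + 1 by omega, pow_succ]
      linarith
  rcases le_or_gt n i with h | h
  · obtain ⟨d, hd⟩ := Nat.exists_eq_add_of_le h
    have h1 := hlow n d hd.symm
    have h2 : ((1 : ℝ) / 100) ^ d ≤ 1 := pow_le_one₀ (by norm_num) (by norm_num)
    linarith
  · obtain ⟨d, rfl⟩ := Nat.exists_eq_add_of_le (Nat.succ_le_of_lt h)
    have h1 := hhigh d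
    have h2 : (0 : ℝ) < (1 / 100) ^ d := by positivity
    exact h1.trans (by linarith)

/-- Schur test for a finite square matrix. -/
theorem norm_toEuclideanCLM_le_of_row_col_sums {ι : Type*} [Fintype ι] [DecidableEq ι]
    (A : Matrix ι ι ℂ) {C : ℝ} (hC : 0 ≤ C) (hrow : ∀ i, ∑ j, ‖A i j‖ ≤ C)
    (hcol : ∀ j, ∑ i, ‖A i j‖ ≤ C) : ‖Matrix.toEuclideanCLM (𝕜 := ℂ) A‖ ≤ C := by
  refine ContinuousLinearMap.opNorm_le_bound _ hC fun x => ?_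
  refine le_of_sq_le_sq ?_ (by positivity)
  rw [mul_pow, EuclideanSpace.norm_sq_eq, EuclideanSpace.norm_sq_eq]
  have hentry : ∀ i, ‖(Matrix.toEuclideanCLM (𝕜 := ℂ) A x) i‖ ^ 2 ≤
      C * ∑ j, ‖A i j‖ * ‖x j‖ ^ 2 := by
    intro i
    have h1 : ‖(Matrix.toEuclideanCLM (𝕜 := ℂ) A x) i‖ ≤ ∑ j, ‖A i j‖ * ‖x j‖ := by
      rw [Matrix.ofLp_toEuclideanCLM]
      refine (norm_sum_le _ _).trans (le_of_eq ?_)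
      simp only [norm_mul]
    have h2 : (∑ j, ‖A i j‖ * ‖x j‖) ^ 2 ≤ (∑ j, ‖A i j‖) * ∑ j, ‖A i j‖ * ‖x j‖ ^ 2 :=
      Finset.sum_sq_le_sum_mul_sum_of_sq_le_mul _ (fun _ _ => by positivity)
        (fun _ _ => by positivity) (fun _ _ => le_of_eq (by ring))
    calc _ ≤ (∑ j, ‖A i j‖ * ‖x j‖) ^ 2 := by gcongr
      _ ≤ _ := h2
      _ ≤ _ := by gcongr; exact hrow i
  calc _ ≤ ∑ i, C * ∑ j, ‖A i j‖ * ‖x j‖ ^ 2 := Finset.sum_le_sum fun i _ => hentry i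
    _ = C * ∑ j, (∑ i, ‖A i j‖) * ‖x j‖ ^ 2 := by
      rw [← Finset.mul_sum, Finset.sum_comm]
      simp only [Finset.sum_mul]
    _ ≤ C * ∑ j, C * ‖x j‖ ^ 2 := by
      gcongr with j
      exact hcol j
    _ = _ := by
      rw [← Finset.mul_sum]
      ring

/-- Under the hypotheses of the construction (with moreover `ε_{j+1} ≥ ε_j / 2` and
`δ ≤ 1/200`), the `n × n` matrix `N` with `ν_{i,i} = 0`, `ν_{i,j} = m_{i,j} / m_{i,i}`
(`i ≠ j`) has operator norm at most `1/2` on the Euclidean space `ℂⁿ`. -/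
theorem statement10 (ε : ℕ → ℝ) (hpos : ∀ j, 1 ≤ j → 0 < ε j)
    (hmono : ∀ j k, 1 ≤ j → j ≤ k → ε k ≤ ε j)
    (hhalf : ∀ j, 1 ≤ j → ε j / 2 ≤ ε (j + 1))
    (hε1 : ε 1 ≤ 2 ^ (-8 : ℤ))
    (δ : ℝ) (hδ1 : ε 1 ≤ δ) (hδ2 : δ ≤ min (1 / 200) (1 - ε 1))
    (n : ℕ) (hn : 1 ≤ n) :
    ‖Matrix.toEuclideanCLM (𝕜 := ℂ)
        (Matrix.of fun i j : Fin n =>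
          if i = j then 0
          else mEntry ε δ (i.1 + 1) (j.1 + 1) / mEntry ε δ (i.1 + 1) (i.1 + 1))‖
      ≤ 1 / 2 := by
  have hδ : 0 < δ := (hpos 1 le_rfl).trans_le hδ1
  have hδ' : δ ≤ 1 / 200 := hδ2.trans (min_le_left _ _)
  have hε1' : ε 1 ≤ 1 := hε1.trans (by norm_num)
  have hsum : ∀ i : Fin n,
      ∑ j : Fin n, (if i.1 = j.1 then 0 else (1 / 100 : ℝ) ^ (Nat.dist i.1 j.1)) ≤ 2 / 99 := by
    intro i
    rw [Fin.sum_univ_eq_sum_range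
      (fun j => if i.1 = j then 0 else (1 / 100 : ℝ) ^ (Nat.dist i.1 j))]
    exact sum_range_geometric_dist_le i.1 n
  have hentry : ∀ i j : Fin n,
      ‖(if i = j then 0
          else mEntry ε δ (i.1 + 1) (j.1 + 1) / mEntry ε δ (i.1 + 1) (i.1 + 1) : ℂ)‖ ≤
        4 * (if i.1 = j.1 then 0 else (1 / 100 : ℝ) ^ (Nat.dist i.1 j.1)) := by
    intro i j
    by_cases h : i = j
    · simp [h]
    · have hne : i.1 ≠ j.1 := fun h' => h (Fin.ext h')
      rw [if_neg h, if_neg hne, ← Nat.dist_add_add_right i.1 1 j.1]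
      exact norm_mEntry_div_le hpos hmono hhalf hε1' hδ hδ' (by omega) (by omega) (by omega)
  refine norm_toEuclideanCLM_le_of_row_col_sums _ (by norm_num) (fun i => ?_) (fun j => ?_)
  · refine (Finset.sum_le_sum fun j _ => hentry i j).trans ?_
    rw [← Finset.mul_sum]
    linarith [hsum i]
  · refine (Finset.sum_le_sum fun i _ => hentry i j).trans ?_
    rw [← Finset.mul_sum]
    simp only [eq_comm (b := j.1), Nat.dist_comm _ j.1]
    linarith [hsum j]
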